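/- Let G be a graph in 𝒢₀, let u be a vertex of G, and let u₁, u₂, u₃ be any three distinct neighbors of u. Then {u, u₁, u₂, u₃} is not a cutset of G, i.e., deleting these four vertices does not disconnect G. -/

import Mathlib

open SimpleGraph

/-- A *hole* of length `n` in `G`: an induced cycle of length `n ≥ 4`. -/
def SimpleGraph.HasHole {V : Type*} (G : SimpleGraph V) (n : ℕ) : Prop :=
  4 ≤ n ∧ ∃ (v : V) (w : G.Walk v v), w.IsCycle ∧ w.toSubgraph.IsInduced ∧ w.length = n

/-- `G ∈ 𝒢_ℓ`: `G` has girth `2ℓ+1` and no odd hole of length at least `2ℓ+3`. -/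
def SimpleGraph.MemGFamily {V : Type*} (G : SimpleGraph V) (l : ℕ) : Prop :=
  G.egirth = (2 * l + 1 : ℕ) ∧ ∀ n : ℕ, Odd n → 2 * l + 3 ≤ n → ¬ G.HasHole n

/-- `G ∈ 𝒢₀`: `G ∈ 𝒢₂`, `χ(G) = 4`, and every proper subgraph of `G` is 3-colorable. -/
def SimpleGraph.MemG0 {V : Type*} (G : SimpleGraph V) : Prop :=
  G.MemGFamily 2 ∧ G.chromaticNumber = 4 ∧
    ∀ H : G.Subgraph, H ≠ ⊤ → H.coe.Colorable 3

/-- `X` is a cutset of `G`: deleting the vertices of `X` disconnects `G`. -/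
def SimpleGraph.IsCutset {V : Type*} (G : SimpleGraph V) (X : Set V) : Prop :=
  ¬ (G.induce (Xᶜ : Set V)).Connected

/-- `G` is 3-connected: more than 3 vertices, and deleting any at most 2 vertices
leaves a connected graph. -/
def SimpleGraph.ThreeConnected {V : Type*} [Fintype V] (G : SimpleGraph V) : Prop :=
  3 < Fintype.card V ∧ ∀ X : Set V, X.ncard ≤ 2 → (G.induce (Xᶜ : Set V)).Connected


/-- A segment of a walk. -/
lemma exists_walk_segment {α : Type*} {H : SimpleGraph α} {a b : α} (p : H.Walk a b)
    (i j : ℕ) (hij : i ≤ j) (hj : j ≤ p.length) :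
    ∃ q : H.Walk (p.getVert i) (p.getVert j), q.length = j - i := by
  have e : (p.drop i).getVert (j - i) = p.getVert j := by
    rw [Walk.drop_getVert]; congr 1; omega
  refine ⟨((p.drop i).take (j - i)).copy rfl e, ?_⟩
  simp [Walk.take_length, Walk.drop_length]
  omega

/-- A graph that is not bipartite has an induced odd cycle. -/
lemma exists_induced_odd_cycle {α : Type*} (H : SimpleGraph α) (h : ¬ H.Colorable 2) :
    ∃ (v : α) (w : H.Walk v v), Odd w.length ∧ w.IsCycle ∧ w.toSubgraph.IsInduced := by
  classical
  rw [two_colorable_iff_forall_loop_even] at h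
  push Not at h
  have hex : ∃ n, ∃ (v : α) (w : H.Walk v v), Odd w.length ∧ w.length = n := by
    obtain ⟨v, w, hw⟩ := h
    exact ⟨_, v, w, by simpa using hw, rfl⟩
  obtain ⟨v, w, hodd, hlen⟩ := Nat.find_spec hex
  have hmin : ∀ (x : α) (q : H.Walk x x), Odd q.length → w.length ≤ q.length := by
    intro x q hq
    rw [hlen]
    exact Nat.find_min' hex ⟨x, q, hq, rfl⟩
  have hne1 : w.length ≠ 1 := by
    intro h1
    have := w.adj_getVert_succ (i := 0) (by omega)
    have h2 : w.getVert 1 = v := by rw [← h1]; exact w.getVert_length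
    rw [h2, w.getVert_zero] at this
    exact this.ne rfl
  have hinj : ∀ i j, i < j → j < w.length → w.getVert i ≠ w.getVert j := by
    intro i j hij hj he
    obtain ⟨q1, hq1⟩ := exists_walk_segment w i j hij.le hj.le
    obtain ⟨q2, hq2⟩ := exists_walk_segment w 0 i (by omega) (by omega)
    obtain ⟨q3, hq3⟩ := exists_walk_segment w j w.length hj.le le_rfl
    have e1 := hmin _ (q1.copy rfl he.symm)
    have e2 := hmin _ ((((q2.copy rfl he).append q3)).copy w.getVert_zero w.getVert_length)
    simp only [Walk.length_copy, Walk.length_append, hq1, hq2, hq3] at e1 e2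
    rcases Nat.even_or_odd (j - i) with hp | hp
    · have : Odd (i - 0 + (w.length - j)) := by
        rw [Nat.odd_iff] at hodd ⊢; rw [Nat.even_iff] at hp; omega
      have := e2 this
      omega
    · have := e1 hp
      omega
  have hchord : ∀ i j, i < j → j < w.length → H.Adj (w.getVert i) (w.getVert j) →
      j = i + 1 ∨ (i = 0 ∧ j + 1 = w.length) := by
    intro i j hij hj ha
    by_contra hcon
    obtain ⟨q1, hq1⟩ := exists_walk_segment w i j hij.le hj.le
    obtain ⟨q2, hq2⟩ := exists_walk_segment w 0 i (by omega) (by omega)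
    obtain ⟨q3, hq3⟩ := exists_walk_segment w j w.length hj.le le_rfl
    have e1 := hmin _ (Walk.cons ha.symm q1)
    have e2 := hmin _ (((q2.append (Walk.cons ha q3))).copy w.getVert_zero w.getVert_length)
    simp only [Walk.length_copy, Walk.length_append, Walk.length_cons, hq1, hq2, hq3] at e1 e2
    rcases Nat.even_or_odd (j - i + 1) with hp | hp
    · have : Odd (i - 0 + (w.length - j + 1)) := by
        rw [Nat.odd_iff] at hodd ⊢; rw [Nat.even_iff] at hp; omega
      have := e2 this
      omega
    · have := e1 hp
      omega
  have hlen3 : 3 ≤ w.length := by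
    rw [Nat.odd_iff] at hodd; omega
  have hcyc : w.IsCycle := by
    rw [Walk.isCycle_iff_isPath_tail_and_le_length]
    refine ⟨?_, hlen3⟩
    rw [← Walk.IsPath.getVert_injOn_iff]
    have key : ∀ i j, i < j → j ≤ w.tail.length → w.tail.getVert i ≠ w.tail.getVert j := by
      intro i j hij hj
      have hl : w.tail.length + 1 = w.length :=
        Walk.length_tail_add_one (by intro hn; rw [← Walk.length_eq_zero_iff] at hn; omega)
      rw [Walk.getVert_tail, Walk.getVert_tail]
      rcases Nat.lt_or_ge (j + 1) w.length with h1 | h1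
      · exact hinj _ _ (by omega) h1
      · have : j + 1 = w.length := by omega
        rw [this, w.getVert_length]
        have := hinj 0 (i + 1) (by omega) (by omega)
        rw [w.getVert_zero] at this
        exact this.symm
    intro i hi j hj he
    rcases lt_trichotomy i j with hlt | heq | hlt
    · exact absurd he (key i j hlt hj)
    · exact heq
    · exact absurd he.symm (key j i hlt hi)
  refine ⟨v, w, hodd, hcyc, ?_⟩
  have hrep : ∀ x, x ∈ w.toSubgraph.verts → ∃ i, i < w.length ∧ w.getVert i = x := by
    intro x hx
    rw [Walk.mem_verts_toSubgraph, Walk.mem_support_iff_exists_getVert] at hx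
    obtain ⟨i, hi, hle⟩ := hx
    rcases hle.lt_or_eq with h1 | h1
    · exact ⟨i, h1, hi⟩
    · refine ⟨0, by omega, ?_⟩
      rw [← hi, h1, w.getVert_zero, w.getVert_length]
  have main : ∀ i j, i < j → j < w.length → H.Adj (w.getVert i) (w.getVert j) →
      w.toSubgraph.Adj (w.getVert i) (w.getVert j) := by
    intro i j hij hj ha
    rcases hchord i j hij hj ha with rfl | ⟨rfl, h1⟩
    · exact w.toSubgraph_adj_getVert (by omega)
    · have := w.toSubgraph_adj_getVert hj
      rw [h1, w.getVert_length] at this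
      rw [w.getVert_zero]
      exact this.symm
  intro x hx y hy ha
  obtain ⟨i, hi, rfl⟩ := hrep x hx
  obtain ⟨j, hj, rfl⟩ := hrep y hy
  rcases lt_trichotomy i j with hlt | heq | hlt
  · exact main i j hlt hj ha
  · subst heq; exact absurd rfl ha.ne
  · exact (main j i hlt hi ha.symm).symm

/-- An induced odd cycle in an induced subgraph yields a pentagon, in graphs of `𝒢₂`. -/
lemma exists_pentagon {V : Type*} (G : SimpleGraph V) (hG : G.MemGFamily 2) (W : Set V)
    (h : ¬ (G.induce W).Colorable 2) :
    ∃ x : ℕ → V, (∀ i, x i ∈ W) ∧ (∀ i < 5, G.Adj (x i) (x (i + 1))) ∧ x 5 = x 0 := by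
  obtain ⟨v, w, hodd, hcyc, hind⟩ := exists_induced_odd_cycle _ h
  let f : G.induce W ↪g G := Embedding.induce W
  have hcyc' : (w.map f.toHom).IsCycle := hcyc.map f.injective
  have hge : (5 : ℕ∞) ≤ ((w.map f.toHom).length : ℕ∞) := by
    have := hG.1
    have h2 := le_egirth.mp this.ge _ _ hcyc'
    simpa using h2
  have hge' : 5 ≤ w.length := by
    have : 5 ≤ (w.map f.toHom).length := by exact_mod_cast hge
    simpa using this
  have h5 : w.length = 5 := by
    by_contra hne
    refine hG.2 w.length hodd ?_ ⟨by omega, f v, w.map f.toHom, hcyc', ?_, by simp⟩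
    · rw [Nat.odd_iff] at hodd; omega
    · intro x hx y hy ha
      rw [Walk.toSubgraph_map] at hx hy ⊢
      obtain ⟨x', hx', rfl⟩ := hx
      obtain ⟨y', hy', rfl⟩ := hy
      exact ⟨x', y', hind hx' hy' (f.map_adj_iff.mp ha), rfl, rfl⟩
  refine ⟨fun i => (w.getVert i : V), fun i => (w.getVert i).2, ?_, ?_⟩
  · intro i hi
    exact w.adj_getVert_succ (by omega)
  · simp only
    rw [← h5, w.getVert_length, w.getVert_zero]

lemma no_triangle {V : Type*} (G : SimpleGraph V) (hG : G.MemGFamily 2) {a b c : V}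
    (hab : G.Adj a b) (hbc : G.Adj b c) (hca : G.Adj c a) : False := by
  have hc : (Walk.cons hab (Walk.cons hbc (Walk.cons hca Walk.nil))).IsCycle := by
    simp [Walk.cons_isCycle_iff, hab.ne, hab.ne', hbc.ne, hbc.ne', hca.ne, hca.ne']
  have h2 := le_egirth.mp hG.1.ge _ _ hc
  simp only [Walk.length_cons, Walk.length_nil] at h2
  have h3 := Nat.cast_le.mp h2
  omega

lemma no_square {V : Type*} (G : SimpleGraph V) (hG : G.MemGFamily 2) {a b c d : V}
    (hab : G.Adj a b) (hbc : G.Adj b c) (hcd : G.Adj c d) (hda : G.Adj d a)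
    (hac : a ≠ c) (hbd : b ≠ d) : False := by
  have hc : (Walk.cons hab (Walk.cons hbc (Walk.cons hcd (Walk.cons hda Walk.nil)))).IsCycle := by
    simp [Walk.cons_isCycle_iff, hab.ne, hab.ne', hbc.ne, hbc.ne', hcd.ne, hcd.ne', hda.ne,
      hda.ne', hac, hac.symm, hbd, hbd.symm]
  have h2 := le_egirth.mp hG.1.ge _ _ hc
  simp only [Walk.length_cons, Walk.length_nil] at h2
  have h3 := Nat.cast_le.mp h2
  omega

/-- A 3-coloring of a proper induced subgraph, normalized at `u`. -/
lemma exists_coloring {V : Type*} (G : SimpleGraph V)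
    (hG : ∀ H : G.Subgraph, H ≠ ⊤ → H.coe.Colorable 3) (S : Set V) (hS : S ≠ Set.univ)
    (u : V) : ∃ c : V → Fin 3, c u = 2 ∧
      ∀ x ∈ S, ∀ y ∈ S, G.Adj x y → c x ≠ c y := by
  classical
  obtain ⟨C⟩ := hG ((⊤ : G.Subgraph).induce S) (by
    intro h
    apply hS
    have := congrArg Subgraph.verts h
    simpa using this)
  let c0 : V → Fin 3 := fun v => if h : v ∈ S then C ⟨v, h⟩ else 0
  refine ⟨fun v => Equiv.swap (c0 u) 2 (c0 v), by simp, ?_⟩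
  intro x hx y hy hxy he
  have he' := (Equiv.swap (c0 u) 2).injective he
  simp only [c0, hx, hy, dif_pos] at he'
  refine C.valid (v := ⟨x, hx⟩) (w := ⟨y, hy⟩) ?_ he'
  simp [Subgraph.coe_adj, hx, hy, hxy]

lemma pentagon_two_color {a b c d e : Fin 3} (ha : a ≠ 2) (hb : b ≠ 2) (hc : c ≠ 2)
    (hd : d ≠ 2) (he : e ≠ 2) (h1 : a ≠ b) (h2 : b ≠ c) (h3 : c ≠ d) (h4 : d ≠ e)
    (h5 : e ≠ a) : False := by
  omega

/-- No star cutset: the main combinatorial argument. -/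
lemma star_separation {V : Type*} (G : SimpleGraph V) (hG : G.MemGFamily 2) (u : V)
    (N A B : Set V) (hN : ∀ x ∈ N, G.Adj u x) (huA : u ∉ A) (huB : u ∉ B)
    (hcover : ∀ x, x = u ∨ x ∈ N ∨ x ∈ A ∨ x ∈ B)
    (hAN : ∀ x ∈ A, x ∉ N) (hBN : ∀ x ∈ B, x ∉ N)
    (hABd : ∀ x ∈ A, x ∉ B)
    (hAB : ∀ x ∈ A, ∀ y ∈ B, ¬ G.Adj x y)
    (c d : V → Fin 3) (hcu : c u = 2) (hdu : d u = 2)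
    (hc : ∀ x, x ∉ B → ∀ y, y ∉ B → G.Adj x y → c x ≠ c y)
    (hd : ∀ x, x ∉ A → ∀ y, y ∉ A → G.Adj x y → d x ≠ d y) : G.Colorable 3 := by
  classical
  let W : Set V := {x | x ≠ u ∧ (x ∈ A → c x ≠ 2) ∧ (x ∈ B → d x ≠ 2)}
  have hNB : ∀ x ∈ N, x ∉ B := fun x hx hb => hBN x hb hx
  have hNA : ∀ x ∈ N, x ∉ A := fun x hx hb => hAN x hb hx
  have hcW : ∀ x ∈ W, x ∉ B → c x ≠ 2 := by
    intro x hx hxB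
    rcases hcover x with h | h | h | h
    · exact absurd h hx.1
    · rw [← hcu]; exact (hc u huB x hxB (hN x h)).symm
    · exact hx.2.1 h
    · exact absurd h hxB
  have hdW : ∀ x ∈ W, x ∉ A → d x ≠ 2 := by
    intro x hx hxA
    rcases hcover x with h | h | h | h
    · exact absurd h hx.1
    · rw [← hdu]; exact (hd u huA x hxA (hN x h)).symm
    · exact absurd h hxA
    · exact hx.2.2 h
  have hW : (G.induce W).Colorable 2 := by
    by_contra hcon
    obtain ⟨x, hxW, hadj, h50⟩ := exists_pentagon G hG W hcon
    have a0 := hadj 0 (by omega)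
    have a1 := hadj 1 (by omega)
    have a2 := hadj 2 (by omega)
    have a3 := hadj 3 (by omega)
    have a4 := hadj 4 (by omega)
    norm_num at a0 a1 a2 a3 a4
    rw [h50] at a4
    -- adjacent vertices are not both in `N`
    have hn1 : ∀ p q, G.Adj p q → p ∈ N → q ∉ N := fun p q hpq hp hq =>
      no_triangle G hG (hN p hp) hpq (hN q hq).symm
    -- vertices with a common neighbour in `W` are not both in `N`
    have hn2 : ∀ p m q, m ∈ W → p ≠ q → G.Adj p m → G.Adj m q → p ∈ N → q ∉ N := by
      intro p m q hm hpq hpm hmq hp hq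
      exact no_square G hG (hN p hp) hpm hmq (hN q hq).symm hm.1.symm hpq
    have d02 : x 0 ≠ x 2 := by
      intro h; rw [← h] at a2
      exact no_triangle G hG a2 a3 a4
    have d13 : x 1 ≠ x 3 := by
      intro h; rw [← h] at a3
      exact no_triangle G hG a3 a4 a0
    have d24 : x 2 ≠ x 4 := by
      intro h; rw [← h] at a4
      exact no_triangle G hG a4 a0 a1
    have d30 : x 3 ≠ x 0 := by
      intro h; rw [h] at a2
      exact no_triangle G hG a0 a1 a2
    have d41 : x 4 ≠ x 1 := by
      intro h; rw [h] at a3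
      exact no_triangle G hG a1 a2 a3
    have n01 := hn1 _ _ a0
    have n12 := hn1 _ _ a1
    have n23 := hn1 _ _ a2
    have n34 := hn1 _ _ a3
    have n40 := hn1 _ _ a4
    have n02 := hn2 _ _ _ (hxW 1) d02 a0 a1
    have n13 := hn2 _ _ _ (hxW 2) d13 a1 a2
    have n24 := hn2 _ _ _ (hxW 3) d24 a2 a3
    have n30 := hn2 _ _ _ (hxW 4) d30 a3 a4
    have n41 := hn2 _ _ _ (hxW 0) d41 a4 a0
    have hcov : ∀ i, x i ∈ N ∨ x i ∈ A ∨ x i ∈ B := fun i =>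
      (hcover (x i)).resolve_left (hxW i).1
    have s : ∀ p q, G.Adj p q → ¬ (p ∈ A ∧ q ∈ B) ∧ ¬ (p ∈ B ∧ q ∈ A) := fun p q hpq =>
      ⟨fun h => hAB p h.1 q h.2 hpq, fun h => hAB q h.2 p h.1 hpq.symm⟩
    have s0 := s _ _ a0
    have s1 := s _ _ a1
    have s2 := s _ _ a2
    have s3 := s _ _ a3
    have s4 := s _ _ a4
    have hdich : (x 0 ∉ A ∧ x 1 ∉ A ∧ x 2 ∉ A ∧ x 3 ∉ A ∧ x 4 ∉ A) ∨
        (x 0 ∉ B ∧ x 1 ∉ B ∧ x 2 ∉ B ∧ x 3 ∉ B ∧ x 4 ∉ B) := by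
      have c0 := hcov 0
      have c1 := hcov 1
      have c2 := hcov 2
      have c3 := hcov 3
      have c4 := hcov 4
      have e0 := hABd (x 0)
      have e1 := hABd (x 1)
      have e2 := hABd (x 2)
      have e3 := hABd (x 3)
      have e4 := hABd (x 4)
      clear * - c0 c1 c2 c3 c4 e0 e1 e2 e3 e4 s0 s1 s2 s3 s4 n01 n12 n23 n34 n40 n02 n13 n24 n30 n41
      grind
    rcases hdich with ⟨h0, h1, h2, h3, h4⟩ | ⟨h0, h1, h2, h3, h4⟩
    · exact pentagon_two_color (hdW _ (hxW 0) h0) (hdW _ (hxW 1) h1) (hdW _ (hxW 2) h2)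
        (hdW _ (hxW 3) h3) (hdW _ (hxW 4) h4) (hd _ h0 _ h1 a0) (hd _ h1 _ h2 a1)
        (hd _ h2 _ h3 a2) (hd _ h3 _ h4 a3) (hd _ h4 _ h0 a4)
    · exact pentagon_two_color (hcW _ (hxW 0) h0) (hcW _ (hxW 1) h1) (hcW _ (hxW 2) h2)
        (hcW _ (hxW 3) h3) (hcW _ (hxW 4) h4) (hc _ h0 _ h1 a0) (hc _ h1 _ h2 a1)
        (hc _ h2 _ h3 a2) (hc _ h3 _ h4 a3) (hc _ h4 _ h0 a4)
  obtain ⟨C⟩ := hW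
  -- the complement of `W` is stable
  have hWc : ∀ x y, x ∉ W → y ∉ W → ¬ G.Adj x y := by
    have key : ∀ x, x ∉ W → (x = u ∧ c x = 2 ∧ d x = 2) ∨ (x ∈ A ∧ c x = 2) ∨
        (x ∈ B ∧ d x = 2) := by
      intro x hx
      by_cases hxu : x = u
      · left; subst hxu; exact ⟨rfl, hcu, hdu⟩
      · right
        by_contra hcon
        push Not at hcon
        exact hx ⟨hxu, hcon.1, hcon.2⟩
    have hBA : ∀ x ∈ B, x ∉ A := fun x hx ha => hABd x ha hx
    intro x y hx hy ha
    rcases key x hx with ⟨rfl, h1, h2⟩ | ⟨h1, h2⟩ | ⟨h1, h2⟩ <;>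
    rcases key y hy with ⟨rfl, k1, k2⟩ | ⟨k1, k2⟩ | ⟨k1, k2⟩
    · exact ha.ne rfl
    · exact hc _ huB _ (hABd _ k1) ha (h1.trans k2.symm)
    · exact hd _ huA _ (hBA _ k1) ha (h2.trans k2.symm)
    · exact hc _ (hABd _ h1) _ huB ha (h2.trans k1.symm)
    · exact hc _ (hABd _ h1) _ (hABd _ k1) ha (h2.trans k2.symm)
    · exact hAB _ h1 _ k1 ha
    · exact hd _ (hBA _ h1) _ huA ha (h2.trans k2.symm)
    · exact hAB _ k1 _ h1 ha.symm
    · exact hd _ (hBA _ h1) _ (hBA _ k1) ha (h2.trans k2.symm)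
  refine ⟨Coloring.mk (fun v => if h : v ∈ W then (C ⟨v, h⟩).castSucc else Fin.last 2) ?_⟩
  intro x y hxy
  by_cases hx : x ∈ W <;> by_cases hy : y ∈ W
  · simp only [hx, hy, dif_pos]
    intro he
    exact C.valid (v := ⟨x, hx⟩) (w := ⟨y, hy⟩) hxy (Fin.castSucc_injective _ he)
  · simp only [hx, hy, dif_pos, dif_neg, not_false_eq_true]
    exact (Fin.castSucc_lt_last _).ne
  · simp only [hx, hy, dif_pos, dif_neg, not_false_eq_true]
    exact (Fin.castSucc_lt_last _).ne'
  · exact absurd hxy (hWc x y hx hy)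

/-- for `G ∈ 𝒢₀`, a vertex `u` and three distinct neighbors `u₁, u₂, u₃` of `u`,
the set `{u, u₁, u₂, u₃}` is not a cutset of `G`. -/
theorem stmt_6 {V : Type*} [Fintype V] (G : SimpleGraph V) (hG : G.MemG0)
    (u u₁ u₂ u₃ : V) (h1 : G.Adj u u₁) (h2 : G.Adj u u₂) (h3 : G.Adj u u₃)
    (h12 : u₁ ≠ u₂) (h13 : u₁ ≠ u₃) (h23 : u₂ ≠ u₃) :
    ¬ G.IsCutset {u, u₁, u₂, u₃} := by
  classical
  obtain ⟨hF, hchi, hcrit⟩ := hG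
  have hnc : ¬ G.Colorable 3 := by
    intro h
    have := h.chromaticNumber_le
    rw [hchi] at this
    have h' : (4 : ℕ) ≤ 3 := by exact_mod_cast this
    omega
  unfold SimpleGraph.IsCutset
  rw [not_not]
  by_contra hdis
  apply hnc
  set X : Set V := {u, u₁, u₂, u₃} with hX
  let N : Set V := {u₁, u₂, u₃}
  have hN : ∀ x ∈ N, G.Adj u x := by
    rintro x (rfl | rfl | rfl) <;> assumption
  have hXN : ∀ x, x ∈ X ↔ x = u ∨ x ∈ N := fun x => Iff.rfl
  have huX : u ∈ X := Or.inl rfl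
  have hNX : ∀ x ∈ N, x ∈ X := fun x hx => Or.inr hx
  by_cases hemp : Nonempty (Xᶜ : Set V)
  · have hpre : ¬ (G.induce (Xᶜ : Set V)).Preconnected := fun h => hdis ⟨h⟩
    unfold SimpleGraph.Preconnected at hpre
    push Not at hpre
    obtain ⟨a, b, hab⟩ := hpre
    let A : Set V := {x | ∃ h : x ∈ Xᶜ, (G.induce (Xᶜ : Set V)).Reachable a ⟨x, h⟩}
    let B : Set V := {x | x ∉ X ∧ x ∉ A}
    have hAX : ∀ x ∈ A, x ∉ X := fun x hx => hx.1
    have haA : a.1 ∈ A := ⟨a.2, Reachable.refl _⟩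
    have hbB : b.1 ∈ B := ⟨b.2, fun ⟨_, h⟩ => hab h⟩
    obtain ⟨c, hcu, hc⟩ := exists_coloring G hcrit Bᶜ
      (fun h => absurd (h ▸ Set.mem_univ b.1 : b.1 ∈ Bᶜ) (fun h => h hbB)) u
    obtain ⟨d, hdu, hd⟩ := exists_coloring G hcrit Aᶜ
      (fun h => absurd (h ▸ Set.mem_univ a.1 : a.1 ∈ Aᶜ) (fun h => h haA)) u
    refine star_separation G hF u N A B hN (fun h => hAX u h huX) (fun h => h.1 huX) ?_
      (fun x hx hn => hAX x hx (hNX x hn)) (fun x hx hn => hx.1 (hNX x hn))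
      (fun x hx hb => hb.2 hx) ?_ c d hcu hdu
      (fun x hx y hy => hc x hx y hy) (fun x hx y hy => hd x hx y hy)
    · intro x
      by_cases hxX : x ∈ X
      · rcases (hXN x).mp hxX with h | h
        · exact Or.inl h
        · exact Or.inr (Or.inl h)
      · by_cases hxA : x ∈ A
        · exact Or.inr (Or.inr (Or.inl hxA))
        · exact Or.inr (Or.inr (Or.inr ⟨hxX, hxA⟩))
    · rintro x ⟨hx, hr⟩ y ⟨hyX, hyA⟩ hxy
      refine hyA ⟨hyX, hr.trans (Adj.reachable ?_)⟩
      exact hxy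
  · have hall : ∀ x, x = u ∨ x ∈ N := by
      intro x
      by_contra hx
      exact hemp ⟨⟨x, fun h => hx ((hXN x).mp h)⟩⟩
    refine ⟨Coloring.mk (fun v => if v = u then 0 else 1) ?_⟩
    intro x y hxy
    by_cases hx : x = u <;> by_cases hy : y = u
    · subst hx; subst hy; exact absurd rfl hxy.ne
    · simp [hx, hy]
    · simp [hx, hy]
    · exact (no_triangle G hF (hN x ((hall x).resolve_left hx)) hxy
        (hN y ((hall y).resolve_left hy)).symm).elim
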